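/- Let R be a Noetherian local ring of dimension at most 2, I an ideal of R, and M a finitely generated R-module. Then H^i_I(M) is I-cofinite for all i ≥ 0. -/

import Mathlib

open CategoryTheory

noncomputable section

universe u

/-- The Krull dimension of a module: `dim R/ann(M)`. -/
def moduleDim (R : Type u) [CommRing R] (M : Type*) [AddCommGroup M] [Module R M] :
    WithBot (WithTop ℕ) :=
  ringKrullDim (R ⧸ Module.annihilator R M)

/-- The depth of `M` with respect to an ideal `J`: the supremum of the lengths of
`M`-regular sequences consisting of elements of `J`. -/
def moduleDepth (R : Type u) [CommRing R] (J : Ideal R) (M : Type*) [AddCommGroup M]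
    [Module R M] : ℕ∞ :=
  sSup {n : ℕ∞ | ∃ rs : List R, (rs.length : ℕ∞) = n ∧ (∀ r ∈ rs, r ∈ J) ∧
    RingTheory.Sequence.IsRegular M rs}

/-- Serre's condition `S_ℓ` : for every prime `p` in the support of `M`,
`depth M_p ≥ min (ℓ, dim M_p)`. -/
def SerreCondition (R : Type u) [CommRing R] (ℓ : ℕ) (M : Type u) [AddCommGroup M]
    [Module R M] : Prop :=
  ∀ p ∈ Module.support R M,
    min ((ℓ : ℕ∞) : WithBot ℕ∞)
        (moduleDim (Localization.AtPrime p.asIdeal) (LocalizedModule p.asIdeal.primeCompl M)) ≤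
      ((moduleDepth (Localization.AtPrime p.asIdeal)
          (IsLocalRing.maximalIdeal (Localization.AtPrime p.asIdeal))
          (LocalizedModule p.asIdeal.primeCompl M) : ℕ∞) : WithBot ℕ∞)

/-- A module `N` over `S` is `J`-cofinite if its support is contained in `V(J)` and all the
modules `Ext^i_S(S/J, N)` are finitely generated. -/
def IsCofinite (S : Type u) [CommRing S] (J : Ideal S) (N : ModuleCat.{u} S) : Prop :=
  Module.support S N ⊆ PrimeSpectrum.zeroLocus (J : Set S) ∧
  ∀ i : ℕ, Module.Finite S
    (((Ext S (ModuleCat.{u} S) i).obj (Opposite.op (ModuleCat.of S (S ⧸ J)))).obj N)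

/-- A ring is catenary if any two saturated chains of primes with the same endpoints have
the same length. -/
def IsCatenaryRing (R : Type u) [CommRing R] : Prop :=
  ∀ c₁ c₂ : LTSeries (PrimeSpectrum R),
    c₁.head = c₂.head → c₁.last = c₂.last →
    (∀ i : Fin c₁.length, c₁.toFun i.castSucc ⋖ c₁.toFun i.succ) →
    (∀ i : Fin c₂.length, c₂.toFun i.castSucc ⋖ c₂.toFun i.succ) →
    c₁.length = c₂.length

/-- A module is indecomposable if it is nonzero and is not the internal direct sum of two
nonzero submodules. -/
def ModuleIndecomposable (R : Type u) [CommRing R] (M : Type*) [AddCommGroup M]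
    [Module R M] : Prop :=
  Nontrivial M ∧ ∀ N₁ N₂ : Submodule R M, IsCompl N₁ N₂ → N₁ = ⊥ ∨ N₂ = ⊥

/-- A module is equidimensional if `dim R/P = dim M` for every minimal prime `P`
of its support (equivalently, of its annihilator). -/
def Equidimensional (R : Type u) [CommRing R] (M : Type*) [AddCommGroup M]
    [Module R M] : Prop :=
  ∀ P ∈ (Module.annihilator R M).minimalPrimes, ringKrullDim (R ⧸ P) = moduleDim R M

/-- A local ring is Cohen-Macaulay if its depth equals its Krull dimension. -/
def IsCMLocalRing (S : Type u) [CommRing S] [IsLocalRing S] : Prop :=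
  ((moduleDepth S (IsLocalRing.maximalIdeal S) S : ℕ∞) : WithBot ℕ∞) = ringKrullDim S

/-- A ring is Cohen-Macaulay if all its localizations at primes are Cohen-Macaulay local
rings. -/
def IsCMRing (S : Type u) [CommRing S] : Prop :=
  ∀ p : PrimeSpectrum S, IsCMLocalRing (Localization.AtPrime p.asIdeal)

namespace CategoryTheory.ProjectiveResolution

open HomologicalComplex

variable {R : Type*} [CommRing R] {C : Type*} [Category* C] [Abelian C] [Linear R C]

section Ext
variable {X : C} (P : ProjectiveResolution X) (Y : C)

variable (R)

/-- The inclusion of the `n`-cocycles of `Hom(P, Y)` in `Hom(P_n, Y)`. -/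
def homOfCycles (n : ℕ) :
    (P.complex.linearYonedaObj R Y).cycles n →ₗ[R] (P.complex.X n ⟶ Y) :=
  ((P.complex.linearYonedaObj R Y).iCycles n).hom

variable {R Y}

lemma d_comp_homOfCycles {n : ℕ} (z : (P.complex.linearYonedaObj R Y).cycles n) :
    P.complex.d (n + 1) n ≫ P.homOfCycles R Y n z = 0 :=
  congr($((P.complex.linearYonedaObj R Y).iCycles_d n (n + 1)) z)

lemma exists_homOfCycles_eq {n : ℕ} (f : P.complex.X n ⟶ Y)
    (hf : P.complex.d (n + 1) n ≫ f = 0) : ∃ z, P.homOfCycles R Y n z = f := by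
  let K := P.complex.linearYonedaObj R Y
  have hex : (ShortComplex.mk _ _ (K.iCycles_d n (n + 1))).Exact :=
    ShortComplex.exact_of_f_is_kernel _ (K.cyclesIsKernel n (n + 1) (by simp))
  rw [ShortComplex.moduleCat_exact_iff] at hex
  exact hex f hf

variable (R Y)

lemma homologyπ_surjective (n : ℕ) : Function.Surjective
    ((P.complex.linearYonedaObj R Y).homologyπ n).hom :=
  (ModuleCat.epi_iff_surjective _).1 inferInstance

lemma homOfCycles_injective (n : ℕ) : Function.Injective (P.homOfCycles R Y n) :=
  (ModuleCat.mono_iff_injective ((P.complex.linearYonedaObj R Y).iCycles n)).1 inferInstance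

lemma homologyπ_eq_zero_iff {n : ℕ} (z : (P.complex.linearYonedaObj R Y).cycles n) :
    ((P.complex.linearYonedaObj R Y).homologyπ n).hom z = 0 ↔
      ∃ g : P.complex.X ((ComplexShape.up ℕ).prev n) ⟶ Y,
        P.complex.d n _ ≫ g = P.homOfCycles R Y n z := by
  let K := P.complex.linearYonedaObj R Y
  have hex : (ShortComplex.mk _ _ (K.toCycles_comp_homologyπ
      ((ComplexShape.up ℕ).prev n) n)).Exact :=
    ShortComplex.exact_of_g_is_cokernel _ (K.homologyIsCokernel _ n rfl)
  rw [ShortComplex.moduleCat_exact_iff] at hex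
  constructor
  · intro h
    obtain ⟨g, hg⟩ := hex z h
    refine ⟨g, ?_⟩
    rw [← hg]
    exact congr($(K.toCycles_i ((ComplexShape.up ℕ).prev n) n) g).symm
  · rintro ⟨g, hg⟩
    have : (K.toCycles ((ComplexShape.up ℕ).prev n) n).hom g = z := by
      apply P.homOfCycles_injective R Y n
      rw [← hg]
      exact congr($(K.toCycles_i ((ComplexShape.up ℕ).prev n) n) g)
    rw [← this]
    exact congr($(K.toCycles_comp_homologyπ ((ComplexShape.up ℕ).prev n) n) g)

variable [HasExt C]

variable {R Y} in
lemma smul_extMk {n : ℕ} (f : P.complex.X n ⟶ Y) (m : ℕ) (hm : n + 1 = m)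
    (hf : P.complex.d m n ≫ f = 0) (r : R) :
    r • P.extMk f m hm hf = P.extMk (r • f) m hm (by simp [hf]) := by
  rw [Abelian.Ext.smul_eq_comp_mk₀, extMk_comp_mk₀]
  simp

variable {Y} in
lemma extMk_zero_eq_zero_iff (f : P.complex.X 0 ⟶ Y) (hf : P.complex.d 1 0 ≫ f = 0) :
    P.extMk f 1 rfl hf = 0 ↔ f = 0 := by
  refine ⟨fun h ↦ ?_, fun h ↦ by subst h; simp⟩
  simp only [← P.extEquivCohomologyClass.apply_eq_iff_eq,
    extEquivCohomologyClass_extMk, extEquivCohomologyClass_zero,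
    CochainComplex.HomComplex.CohomologyClass.mk_eq_zero_iff] at h
  rw [CochainComplex.HomComplex.Cocycle.toSingleMk_mem_coboundaries_iff _ _ _ _ _ 1 (by simp)] at h
  obtain ⟨g, hg⟩ := h
  have hz : Limits.IsZero (P.cochainComplex.X 1) :=
    CochainComplex.isZero_of_isStrictlyLE _ 0 1 (by simp)
  rw [hz.eq_of_src g 0] at hg
  simpa using hg.symm

/-- The `n`-cocycles of `Hom(P, Y)` map onto `Ext^n(X, Y)`. -/
def cyclesToExt (n : ℕ) :
    (P.complex.linearYonedaObj R Y).cycles n →ₗ[R] Abelian.Ext X Y n where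
  toFun z := P.extMk (P.homOfCycles R Y n z) (n + 1) rfl (P.d_comp_homOfCycles z)
  map_add' z w := by simp [add_extMk]
  map_smul' r z := by simp [smul_extMk]

lemma cyclesToExt_surjective (n : ℕ) : Function.Surjective (P.cyclesToExt R Y n) := fun x ↦ by
  obtain ⟨f, hf, rfl⟩ := P.extMk_surjective x (n + 1) rfl
  obtain ⟨z, rfl⟩ := P.exists_homOfCycles_eq (R := R) f hf
  exact ⟨z, rfl⟩

lemma ker_homologyπ_eq_ker_cyclesToExt (n : ℕ) :
    LinearMap.ker ((P.complex.linearYonedaObj R Y).homologyπ n).hom =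
      LinearMap.ker (P.cyclesToExt R Y n) := by
  ext z
  rw [LinearMap.mem_ker, LinearMap.mem_ker, homologyπ_eq_zero_iff]
  change _ ↔ P.extMk (P.homOfCycles R Y n z) (n + 1) rfl (P.d_comp_homOfCycles z) = 0
  cases n with
  | zero =>
    rw [extMk_zero_eq_zero_iff]
    constructor
    · rintro ⟨g, hg⟩
      rw [← hg, P.complex.shape _ _ (by simp), Limits.zero_comp]
    · intro h
      exact ⟨0, by simp [h]⟩
  | succ p =>
    rw [P.extMk_eq_zero_iff _ _ _ _ p rfl]
    rw [show (ComplexShape.up ℕ).prev (p + 1) = p from by simp]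

/-- The cohomology of `Hom(P, Y)` is `Ext^n(X, Y)`. -/
def homologyLinearEquivExt (n : ℕ) :
    (P.complex.linearYonedaObj R Y).homology n ≃ₗ[R] Abelian.Ext X Y n :=
  (LinearMap.quotKerEquivOfSurjective _ (P.homologyπ_surjective R Y n)).symm ≪≫ₗ
    Submodule.quotEquivOfEq _ _ (P.ker_homologyπ_eq_ker_cyclesToExt R Y n) ≪≫ₗ
    LinearMap.quotKerEquivOfSurjective _ (P.cyclesToExt_surjective R Y n)

lemma homologyLinearEquivExt_homologyπ {n : ℕ}
    (z : (P.complex.linearYonedaObj R Y).cycles n) :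
    P.homologyLinearEquivExt R Y n (((P.complex.linearYonedaObj R Y).homologyπ n).hom z) =
      P.cyclesToExt R Y n z := by
  have : (LinearMap.quotKerEquivOfSurjective _ (P.homologyπ_surjective R Y n)).symm
      (((P.complex.linearYonedaObj R Y).homologyπ n).hom z) = Submodule.Quotient.mk z := by
    rw [LinearEquiv.symm_apply_eq]
    rfl
  simp only [homologyLinearEquivExt, LinearEquiv.trans_apply, this]
  rfl

end Ext

section Naturality

/-- A chain map induces a cochain map after applying `Hom(-, Y)`. -/
def linearYonedaMap (R : Type*) [CommRing R] [Linear R C] {K L : ChainComplex C ℕ} (φ : K ⟶ L)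
    (Y : C) : L.linearYonedaObj R Y ⟶ K.linearYonedaObj R Y :=
  (unopFunctor _ _).map ((((linearYoneda R C).obj Y).rightOp.mapHomologicalComplex _).map φ).op

variable {X X' : C} {P : ProjectiveResolution X} {P' : ProjectiveResolution X'} {g : X' ⟶ X}
variable (R)

lemma isoExt_hom_naturality [EnoughProjectives C] (φ : Hom P' P g) (Y : C) (n : ℕ) :
    ((Ext R C n).map g.op).app Y ≫ (P'.isoExt (R := R) n Y).hom =
      (P.isoExt (R := R) n Y).hom ≫ homologyMap (linearYonedaMap R φ.hom Y) n := by
  have h1 := isoLeftDerivedObj_inv_naturality g P' P φ.hom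
    (by simpa using φ.hom_f_zero_comp_π_f_zero)
    ((linearYoneda R C).obj Y).rightOp n
  have h2 := homologyOp_hom_naturality (linearYonedaMap R φ.hom Y) n
  have h3 : (homologyOp (P'.complex.linearYonedaObj R Y) n).inv ≫
      homologyMap ((opFunctor _ _).map (linearYonedaMap R φ.hom Y).op) n =
      (homologyMap (linearYonedaMap R φ.hom Y) n).op ≫
        (homologyOp (P.complex.linearYonedaObj R Y) n).inv :=
    (Iso.inv_comp_eq _).2 (((Iso.eq_comp_inv _).2 h2).trans (Category.assoc _ _ _))
  replace h1 := congr($(h1).unop)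
  replace h3 := congr($(h3).unop)
  refine (Category.assoc _ _ _).symm.trans ?_
  refine (congr($h1 ≫ (homologyOp (P'.complex.linearYonedaObj R Y) n).inv.unop)).trans ?_
  refine (Category.assoc _ _ _).trans ?_
  refine .trans ?_ (Category.assoc _ _ _).symm
  exact congr((P.isoLeftDerivedObj ((linearYoneda R C).obj Y).rightOp n).inv.unop ≫ $h3)

variable [HasExt C]

lemma homologyLinearEquivExt_naturality (φ : Hom P' P g) (Y : C) (n : ℕ)
    (x : (P.complex.linearYonedaObj R Y).homology n) :
    P'.homologyLinearEquivExt R Y n ((homologyMap (linearYonedaMap R φ.hom Y) n).hom x) =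
      (Abelian.Ext.mk₀ g).comp (P.homologyLinearEquivExt R Y n x) (zero_add n) := by
  obtain ⟨z, rfl⟩ := P.homologyπ_surjective R Y n x
  have h : (homologyMap (linearYonedaMap R φ.hom Y) n).hom
      (((P.complex.linearYonedaObj R Y).homologyπ n).hom z) =
      ((P'.complex.linearYonedaObj R Y).homologyπ n).hom
        ((cyclesMap (linearYonedaMap R φ.hom Y) n).hom z) :=
    congr($(homologyπ_naturality (linearYonedaMap R φ.hom Y) n) z)
  rw [h, homologyLinearEquivExt_homologyπ, homologyLinearEquivExt_homologyπ]
  refine .trans ?_ (mk₀_comp_extMk (P.homOfCycles R Y n z) (n + 1) rfl (P.d_comp_homOfCycles z) φ).symm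
  change P'.extMk (P'.homOfCycles R Y n _) (n + 1) rfl (P'.d_comp_homOfCycles _) = _
  congr 1
  exact congr($(cyclesMap_i (linearYonedaMap R φ.hom Y) n) z)

end Naturality
end CategoryTheory.ProjectiveResolution

namespace ModuleCat

variable {R : Type u} [CommRing R]

/-- The linear comparison between the two definitions of `Ext` for modules. -/
def extLinearEquiv (X Y : ModuleCat.{u} R) (n : ℕ) :
    ((Ext R (ModuleCat.{u} R) n).obj (Opposite.op X)).obj Y ≃ₗ[R] Abelian.Ext X Y n :=
  ((CategoryTheory.projectiveResolution X).isoExt n Y).toLinearEquiv ≪≫ₗ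
    (CategoryTheory.projectiveResolution X).homologyLinearEquivExt R Y n

lemma extLinearEquiv_naturality {X X' : ModuleCat.{u} R} (g : X' ⟶ X) (Y : ModuleCat.{u} R)
    (n : ℕ) (x : ((Ext R (ModuleCat.{u} R) n).obj (Opposite.op X)).obj Y) :
    extLinearEquiv X' Y n ((((Ext R (ModuleCat.{u} R) n).map g.op).app Y).hom x) =
      (Abelian.Ext.mk₀ g).comp (extLinearEquiv X Y n x) (zero_add n) := by
  let φ : ProjectiveResolution.Hom (CategoryTheory.projectiveResolution X') (CategoryTheory.projectiveResolution X) g :=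
    { hom := ProjectiveResolution.lift g _ _
      hom_f_zero_comp_π_f_zero :=
        (ProjectiveResolution.lift_commutes_zero g _ _).trans (by simp) }
  have h := congr($(ProjectiveResolution.isoExt_hom_naturality R φ Y n) x)
  have h' := ProjectiveResolution.homologyLinearEquivExt_naturality R φ Y n
    (((CategoryTheory.projectiveResolution X).isoExt n Y).hom x)
  exact congr((CategoryTheory.projectiveResolution X').homologyLinearEquivExt R Y n $h).trans h'

end ModuleCat

namespace localCohomology

open Abelian

variable {R : Type u} [CommRing R] (I : Ideal R)

/-- The module `R / I ^ t`. -/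
abbrev quotPow (t : ℕ) : ModuleCat.{u} R := ModuleCat.of R (R ⧸ I ^ t)

/-- The projection `R / I ^ t ⟶ R / I ^ s`. -/
def quotPowMap {s t : ℕ} (h : s ≤ t) : quotPow I t ⟶ quotPow I s :=
  ModuleCat.ofHom (Submodule.mapQ _ _ LinearMap.id (Ideal.pow_le_pow_right h))

/-- The transition maps `Ext^i(R / I ^ s, M) → Ext^i(R / I ^ t, M)`. -/
def transition (M : ModuleCat.{u} R) (i : ℕ) (s t : ℕ) (h : s ≤ t) :
    Abelian.Ext (quotPow I s) M i →ₗ[R] Abelian.Ext (quotPow I t) M i :=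
  (Abelian.Ext.mk₀ (quotPowMap I h)).precompOfLinear R M (zero_add i)

lemma transition_apply (M : ModuleCat.{u} R) (i : ℕ) {s t : ℕ} (h : s ≤ t)
    (x : Abelian.Ext (quotPow I s) M i) :
    transition I M i s t h x = (Abelian.Ext.mk₀ (quotPowMap I h)).comp x (zero_add i) := rfl

instance directedSystem_transition (M : ModuleCat.{u} R) (i : ℕ) :
    DirectedSystem (fun t ↦ Abelian.Ext (quotPow I t) M i) (transition I M i · · ·) where
  map_self t x := by
    have : quotPowMap I (le_refl t) = 𝟙 _ := by
      ext : 1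
      refine LinearMap.ext fun y ↦ ?_
      obtain ⟨y, rfl⟩ := Submodule.Quotient.mk_surjective _ y
      rfl
    rw [transition_apply, this, Abelian.Ext.mk₀_id_comp]
  map_map r t s hst htr x := by
    have : quotPowMap I htr ≫ quotPowMap I hst = quotPowMap I (hst.trans htr) := by
      ext : 1
      refine LinearMap.ext fun y ↦ ?_
      obtain ⟨y, rfl⟩ := Submodule.Quotient.mk_surjective _ y
      rfl
    rw [transition_apply, transition_apply, transition_apply, Abelian.Ext.mk₀_comp_mk₀_assoc, this]

/-- Local cohomology as the direct limit of the modules `Ext^i(R / I ^ t, M)`. -/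
abbrev Model (i : ℕ) (M : ModuleCat.{u} R) : Type u :=
  Module.DirectLimit (fun t ↦ Abelian.Ext (quotPow I t) M i) (transition I M i)

/-- The canonical map `Ext^i(R / I ^ t, M) → H^i_I(M)`. -/
abbrev toModel (i : ℕ) (M : ModuleCat.{u} R) (t : ℕ) :
    Abelian.Ext (quotPow I t) M i →ₗ[R] Model I i M :=
  Module.DirectLimit.of R ℕ _ (transition I M i) t

/-- The cocone over the diagram defining local cohomology with point the concrete model. -/
def modelCocone (i : ℕ) (M : ModuleCat.{u} R) :
    Limits.Cocone (diagram (idealPowersDiagram I) i ⋙ (evaluation _ _).obj M) where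
  pt := ModuleCat.of R (Model I i M)
  ι :=
    { app t := ModuleCat.ofHom (toModel I i M t.unop.unop ∘ₗ
        (ModuleCat.extLinearEquiv (quotPow I t.unop.unop) M i).toLinearMap)
      naturality s t f := by
        ext x
        have := ModuleCat.extLinearEquiv_naturality (quotPowMap I (leOfHom f.unop.unop)) M i x
        exact congr(toModel I i M _ $this).trans
          (Module.DirectLimit.of_f (f := transition I M i) (hij := leOfHom f.unop.unop)) }

/-- Local cohomology agrees with the concrete model. -/
def linearEquivModel (i : ℕ) (M : ModuleCat.{u} R) :
    (localCohomology I i).obj M ≃ₗ[R] Model I i M := by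
  let F := diagram (idealPowersDiagram I) i
  have hF : Limits.HasColimit F := hasColimitDiagram.{u, 0} _ _
  let c := ((evaluation _ _).obj M).mapCocone (Limits.colimit.cocone F)
  let hc : Limits.IsColimit c :=
    Limits.isColimitOfPreserves ((evaluation _ _).obj M) (Limits.colimit.isColimit F)
  let G (t : ℕ) : Abelian.Ext (quotPow I t) M i →ₗ[R] c.pt :=
    (c.ι.app (.op (.op t))).hom ∘ₗ (ModuleCat.extLinearEquiv (quotPow I t) M i).symm.toLinearMap
  have hG (t : ℕ) (x) : G t (ModuleCat.extLinearEquiv (quotPow I t) M i x) =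
      (c.ι.app (.op (.op t))).hom x :=
    congr((c.ι.app (.op (.op t))).hom
      $((ModuleCat.extLinearEquiv (quotPow I t) M i).symm_apply_apply x))
  have hGt (s t : ℕ) (h : s ≤ t) (x) : G t (transition I M i s t h x) = G s x := by
    obtain ⟨x, rfl⟩ := (ModuleCat.extLinearEquiv (quotPow I s) M i).surjective x
    rw [hG]
    have := ModuleCat.extLinearEquiv_naturality (quotPowMap I h) M i x
    refine congr(G t $this).symm.trans ((hG t _).trans ?_)
    exact congr($(c.w (homOfLE h).op.op) x)
  let g : Model I i M →ₗ[R] c.pt := Module.DirectLimit.lift R ℕ _ _ G hGt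
  have hg (t : ℕ) (x) : g (toModel I i M t x) = G t x := Module.DirectLimit.lift_of ..
  let d : c.pt →ₗ[R] Model I i M := (hc.desc (modelCocone I i M)).hom
  have hd (t : ℕ) (x) : d ((c.ι.app (.op (.op t))).hom x) =
      toModel I i M t (ModuleCat.extLinearEquiv (quotPow I t) M i x) :=
    congr($(hc.fac (modelCocone I i M) (.op (.op t))) x)
  refine LinearEquiv.ofLinearMap d g (LinearMap.ext fun y ↦ ?_) ?_
  · obtain ⟨t, y, rfl⟩ := Module.DirectLimit.exists_of y
    obtain ⟨y, rfl⟩ := (ModuleCat.extLinearEquiv (quotPow I t) M i).surjective y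
    refine congr(d $(hg t _)).trans (congr(d $(hG t y)).trans (hd t y))
  · refine congr(ModuleCat.Hom.hom $(hc.hom_ext (f := ModuleCat.ofHom (g ∘ₗ d)) (f' := 𝟙 _)
      fun t ↦ ?_))
    ext y
    exact congr(g $(hd t.unop.unop y)).trans ((hg _ _).trans (hG _ y))

end localCohomology

namespace Module.DirectLimit

variable {R : Type*} [Ring R] {ι : Type*} [Preorder ι] [Nonempty ι] [IsDirectedOrder ι]
  [DecidableEq ι]
variable {F G H : ι → Type*} [∀ i, AddCommGroup (F i)] [∀ i, AddCommGroup (G i)]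
  [∀ i, AddCommGroup (H i)] [∀ i, Module R (F i)] [∀ i, Module R (G i)] [∀ i, Module R (H i)]
variable {tF : ∀ i j, i ≤ j → F i →ₗ[R] F j} {tG : ∀ i j, i ≤ j → G i →ₗ[R] G j}
  {tH : ∀ i j, i ≤ j → H i →ₗ[R] H j}

/-- Direct limits of modules are exact. -/
lemma exact_map [DirectedSystem H (tH · · ·)] {f : ∀ i, F i →ₗ[R] G i} {g : ∀ i, G i →ₗ[R] H i}
    (hf : ∀ i j h, f j ∘ₗ tF i j h = tG i j h ∘ₗ f i)
    (hg : ∀ i j h, g j ∘ₗ tG i j h = tH i j h ∘ₗ g i) (hfg : ∀ i, Function.Exact (f i) (g i)) :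
    Function.Exact (map f hf : DirectLimit F tF →ₗ[R] DirectLimit G tG)
      (map g hg : DirectLimit G tG →ₗ[R] DirectLimit H tH) := by
  intro y
  constructor
  · intro hy
    obtain ⟨i, y, rfl⟩ := exists_of y
    rw [map_apply_of] at hy
    obtain ⟨j, hij, hj⟩ := of.zero_exact hy
    rw [← LinearMap.comp_apply, ← hg, LinearMap.comp_apply] at hj
    obtain ⟨x, hx⟩ := (hfg j _).1 hj
    exact ⟨of R ι F tF j x, by rw [map_apply_of, hx, of_f]⟩
  · rintro ⟨x, rfl⟩
    obtain ⟨i, x, rfl⟩ := exists_of x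
    rw [map_apply_of, map_apply_of, (hfg i).apply_apply_eq_zero, map_zero]

end Module.DirectLimit

namespace CategoryTheory.Abelian.Ext

variable {R : Type*} [CommRing R] {C : Type*} [Category* C] [Abelian C] [Linear R C] [HasExt C]
variable {S : ShortComplex C} (hS : S.ShortExact) (X : C) (n : ℕ)

include hS in
lemma exact_postcompOfLinear_f_g :
    Function.Exact ((mk₀ S.f).postcompOfLinear R X (add_zero n))
      ((mk₀ S.g).postcompOfLinear R X (add_zero n)) := fun y ↦ by
  refine ⟨covariant_sequence_exact₂ X hS y, ?_⟩
  rintro ⟨x, rfl⟩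
  change (x.comp (mk₀ S.f) (add_zero n)).comp (mk₀ S.g) (add_zero n) = 0
  simp

lemma exact_postcompOfLinear_g_extClass :
    Function.Exact ((mk₀ S.g).postcompOfLinear R X (add_zero n))
      (hS.extClass.postcompOfLinear R X (rfl : n + 1 = n + 1)) := fun y ↦ by
  refine ⟨covariant_sequence_exact₃ X hS y rfl, ?_⟩
  rintro ⟨x, rfl⟩
  change (x.comp (mk₀ S.g) (add_zero n)).comp hS.extClass rfl = 0
  simp

lemma exact_postcompOfLinear_extClass_f :
    Function.Exact (hS.extClass.postcompOfLinear R X (rfl : n + 1 = n + 1))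
      ((mk₀ S.f).postcompOfLinear R X (add_zero (n + 1))) := fun y ↦ by
  refine ⟨fun hy ↦ covariant_sequence_exact₁ X hS y hy rfl, ?_⟩
  rintro ⟨x, rfl⟩
  change (x.comp hS.extClass rfl).comp (mk₀ S.f) (add_zero _) = 0
  simp

end CategoryTheory.Abelian.Ext

lemma CategoryTheory.Abelian.Ext.smul_eq_zero_of_mem {R : Type u} [CommRing R] {I : Ideal R}
    {M : ModuleCat.{u} R} {i : ℕ} (x : Abelian.Ext (ModuleCat.of R (R ⧸ I)) M i) {r : R}
    (hr : r ∈ I) : r • x = 0 := by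
  have : r • 𝟙 (ModuleCat.of R (R ⧸ I)) = 0 := by
    ext : 1
    refine LinearMap.ext fun y ↦ ?_
    obtain ⟨y, rfl⟩ := Submodule.Quotient.mk_surjective _ y
    exact (Submodule.Quotient.mk_eq_zero _).2 (Ideal.mul_mem_right _ _ hr)
  calc r • x = r • (Abelian.Ext.mk₀ (𝟙 (ModuleCat.of R (R ⧸ I)))).comp x (zero_add i) := by
        rw [Abelian.Ext.mk₀_id_comp]
    _ = 0 := by rw [← Abelian.Ext.smul_comp, ← Abelian.Ext.mk₀_smul, this]; simp

namespace localCohomology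

variable {R : Type u} [CommRing R] (I : Ideal R)

/-- Functoriality of the concrete model of local cohomology. -/
def Model.map (i : ℕ) {M N : ModuleCat.{u} R} (f : M ⟶ N) : Model I i M →ₗ[R] Model I i N :=
  Module.DirectLimit.map
    (fun t ↦ (Abelian.Ext.mk₀ f).postcompOfLinear R (quotPow I t) (add_zero i))
    fun _ _ h ↦ LinearMap.ext fun x ↦
      Abelian.Ext.comp_assoc_of_third_deg_zero (Abelian.Ext.mk₀ (quotPowMap I h)) x _ (zero_add i)

/-- The connecting homomorphism in local cohomology. -/
def Model.δ (i : ℕ) {S : ShortComplex (ModuleCat.{u} R)} (hS : S.ShortExact) :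
    Model I i S.X₃ →ₗ[R] Model I (i + 1) S.X₁ :=
  Module.DirectLimit.map
    (fun t ↦ hS.extClass.postcompOfLinear R (quotPow I t) (rfl : i + 1 = i + 1))
    fun _ _ h ↦ LinearMap.ext fun x ↦
      Abelian.Ext.comp_assoc (Abelian.Ext.mk₀ (quotPowMap I h)) x _ (zero_add i) rfl (by lia)

variable {S : ShortComplex (ModuleCat.{u} R)} (hS : S.ShortExact) (i : ℕ)

include hS in
lemma Model.exact_map_map : Function.Exact (Model.map I i S.f) (Model.map I i S.g) := by
  unfold Model.map
  exact Module.DirectLimit.exact_map _ _ fun _ ↦ Abelian.Ext.exact_postcompOfLinear_f_g hS _ _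

lemma Model.exact_map_δ : Function.Exact (Model.map I i S.g) (Model.δ I i hS) := by
  unfold Model.map Model.δ
  exact Module.DirectLimit.exact_map _ _ fun _ ↦ Abelian.Ext.exact_postcompOfLinear_g_extClass hS _ _

lemma Model.exact_δ_map : Function.Exact (Model.δ I i hS) (Model.map I (i + 1) S.f) := by
  unfold Model.map Model.δ
  exact Module.DirectLimit.exact_map _ _ fun _ ↦ Abelian.Ext.exact_postcompOfLinear_extClass_f hS _ _

lemma Model.map_toModel {M N : ModuleCat.{u} R} (f : M ⟶ N) (t : ℕ)
    (x : Abelian.Ext (quotPow I t) M i) :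
    Model.map I i f (toModel I i M t x) =
      toModel I i N t (x.comp (Abelian.Ext.mk₀ f) (add_zero i)) :=
  Module.DirectLimit.map_apply_of (f := transition I M i) (f' := transition I N i) _ _ x

lemma Model.map_smul_id {M : ModuleCat.{u} R} (r : R) (x : Model I i M) :
    Model.map I i (r • 𝟙 M) x = r • x := by
  obtain ⟨t, x, rfl⟩ := Module.DirectLimit.exists_of x
  rw [Model.map_toModel, ← map_smul, Abelian.Ext.smul_eq_comp_mk₀]

/-- Every element of local cohomology is killed by a power of the ideal. -/
lemma Model.exists_pow_smul_eq_zero {M : ModuleCat.{u} R} (x : Model I i M) :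
    ∃ t : ℕ, ∀ r ∈ I ^ t, r • x = 0 := by
  obtain ⟨t, x, rfl⟩ := Module.DirectLimit.exists_of x
  exact ⟨t, fun r hr ↦ by rw [← map_smul, Abelian.Ext.smul_eq_zero_of_mem x hr, map_zero]⟩

instance Model.subsingleton_succ_of_injective (J : ModuleCat.{u} R) [Injective J] :
    Subsingleton (Model I (i + 1) J) where
  allEq x y := by
    obtain ⟨t, x, y, rfl, rfl⟩ := Module.DirectLimit.exists_of₂ x y
    rw [x.eq_zero_of_injective, y.eq_zero_of_injective]

/-- Degree zero local cohomology embeds in the module. -/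
def Model.toModule (M : ModuleCat.{u} R) : Model I 0 M →ₗ[R] M :=
  Module.DirectLimit.lift R ℕ _ _
    (fun t ↦ LinearMap.applyₗ (Submodule.Quotient.mk (1 : R) : R ⧸ I ^ t) ∘ₗ
      (Abelian.Ext.linearEquiv₀.trans ModuleCat.homLinearEquiv).toLinearMap) fun s t h x ↦ by
    obtain ⟨f, rfl⟩ := (Abelian.Ext.linearEquiv₀ (R := R)).symm.surjective x
    have : transition I M 0 s t h ((Abelian.Ext.linearEquiv₀ (R := R)).symm f) =
        (Abelian.Ext.linearEquiv₀ (R := R)).symm (quotPowMap I h ≫ f) := by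
      rw [transition_apply]
      simp
    rw [this]
    simp only [LinearMap.comp_apply, LinearEquiv.coe_coe, LinearEquiv.trans_apply,
      LinearEquiv.apply_symm_apply]
    rfl

lemma Model.toModule_toModel_mk₀ {M : ModuleCat.{u} R} {t : ℕ} (f : quotPow I t ⟶ M) :
    Model.toModule I M (toModel I 0 M t (Abelian.Ext.mk₀ f)) =
      f.hom (Submodule.Quotient.mk (1 : R) : R ⧸ I ^ t) := by
  refine (Module.DirectLimit.lift_of (f := transition I M 0) _ _ _).trans ?_
  rw [← Abelian.Ext.linearEquiv₀_symm_apply (R := R)]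
  simp only [LinearMap.comp_apply, LinearEquiv.coe_coe, LinearEquiv.trans_apply,
    LinearEquiv.apply_symm_apply]
  rfl

lemma Model.exists_toModel_mk₀ {M : ModuleCat.{u} R} (x : Model I 0 M) :
    ∃ (t : ℕ) (f : quotPow I t ⟶ M), toModel I 0 M t (Abelian.Ext.mk₀ f) = x := by
  obtain ⟨t, x, rfl⟩ := Module.DirectLimit.exists_of x
  obtain ⟨f, rfl⟩ := (Abelian.Ext.linearEquiv₀ (R := R)).symm.surjective x
  exact ⟨t, f, by simp⟩

lemma Model.toModule_injective (M : ModuleCat.{u} R) :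
    Function.Injective (Model.toModule I M) := by
  rw [injective_iff_map_eq_zero]
  intro x hx
  obtain ⟨t, f, rfl⟩ := Model.exists_toModel_mk₀ I x
  rw [Model.toModule_toModel_mk₀] at hx
  have : f = 0 := by
    ext : 1
    refine Submodule.linearMap_qext _ (LinearMap.ext_ring ?_)
    exact hx
  simp [this]

lemma Model.exists_toModule_eq {M : ModuleCat.{u} R} {m : M} {t : ℕ}
    (hm : ∀ r ∈ I ^ t, r • m = 0) : ∃ x, Model.toModule I M x = m := by
  refine ⟨toModel I 0 M t (Abelian.Ext.mk₀ (ModuleCat.ofHom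
    ((I ^ t).liftQ (LinearMap.toSpanSingleton R M m) hm))), ?_⟩
  rw [Model.toModule_toModel_mk₀]
  exact one_smul R m

lemma Model.toModule_map {M N : ModuleCat.{u} R} (f : M ⟶ N) (x : Model I 0 M) :
    Model.toModule I N (Model.map I 0 f x) = f.hom (Model.toModule I M x) := by
  obtain ⟨t, g, rfl⟩ := Model.exists_toModel_mk₀ I x
  rw [Model.map_toModel, Abelian.Ext.mk₀_comp_mk₀, Model.toModule_toModel_mk₀,
    Model.toModule_toModel_mk₀]
  rfl

end localCohomology

/-- Every element of the module is killed by a power of the ideal. -/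
def Ideal.IsPowTorsion {R : Type*} [CommRing R] (I : Ideal R) (M : Type*) [AddCommGroup M]
    [Module R M] : Prop :=
  ∀ m : M, ∃ t : ℕ, ∀ r ∈ I ^ t, r • m = 0

/-- The submodule of elements killed by some power of the ideal. -/
def Ideal.powTorsion {R : Type*} [CommRing R] (I : Ideal R) (M : Type*) [AddCommGroup M]
    [Module R M] : Submodule R M where
  carrier := {m | ∃ t : ℕ, ∀ r ∈ I ^ t, r • m = 0}
  zero_mem' := ⟨0, by simp⟩
  add_mem' := by
    rintro a b ⟨s, hs⟩ ⟨t, ht⟩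
    refine ⟨s + t, fun r hr ↦ ?_⟩
    rw [smul_add, hs r (Ideal.pow_le_pow_right (by lia) hr),
      ht r (Ideal.pow_le_pow_right (by lia) hr), add_zero]
  smul_mem' := by
    rintro c m ⟨t, ht⟩
    exact ⟨t, fun r hr ↦ by rw [smul_comm, ht r hr, smul_zero]⟩

namespace Ideal

variable {R : Type*} [CommRing R] {I : Ideal R} {M N : Type*} [AddCommGroup M] [Module R M]
  [AddCommGroup N] [Module R N]

lemma isPowTorsion_powTorsion : I.IsPowTorsion (I.powTorsion M) := fun m ↦ by
  obtain ⟨t, ht⟩ := m.2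
  exact ⟨t, fun r hr ↦ Subtype.ext (ht r hr)⟩

lemma IsPowTorsion.of_injective (h : I.IsPowTorsion N) {f : M →ₗ[R] N}
    (hf : Function.Injective f) : I.IsPowTorsion M := fun m ↦ by
  obtain ⟨t, ht⟩ := h (f m)
  exact ⟨t, fun r hr ↦ hf (by rw [map_smul, ht r hr, map_zero])⟩

lemma IsPowTorsion.of_surjective (h : I.IsPowTorsion M) {f : M →ₗ[R] N}
    (hf : Function.Surjective f) : I.IsPowTorsion N := fun n ↦ by
  obtain ⟨m, rfl⟩ := hf n
  obtain ⟨t, ht⟩ := h m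
  exact ⟨t, fun r hr ↦ by rw [← map_smul, ht r hr, map_zero]⟩

lemma IsPowTorsion.exists_pow [Module.Finite R M] (h : I.IsPowTorsion M) :
    ∃ t : ℕ, ∀ r ∈ I ^ t, ∀ m : M, r • m = 0 := by
  choose t ht using h
  obtain ⟨s, hs⟩ := Module.Finite.fg_top (R := R) (M := M)
  refine ⟨s.sup t, fun r hr m ↦ ?_⟩
  have hm : m ∈ Submodule.span R (s : Set M) := hs ▸ Submodule.mem_top
  induction hm using Submodule.span_induction with
  | mem x hx => exact ht x r (Ideal.pow_le_pow_right (Finset.le_sup hx) hr)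
  | zero => exact smul_zero r
  | add x y _ _ hx hy => rw [smul_add, hx, hy, add_zero]
  | smul c x _ hx => rw [smul_comm, hx, smul_zero]

end Ideal

/-- The submodule of `I`-power torsion elements of an injective module is injective. -/
lemma Ideal.baer_powTorsion {R : Type u} [CommRing R] [IsNoetherianRing R] (I : Ideal R)
    (E : Type u) [AddCommGroup E] [Module R E] [Module.Injective R E] :
    Module.Baer R (I.powTorsion E) := by
  intro K g
  obtain ⟨t, ht⟩ := (isPowTorsion_powTorsion.of_injective
    (LinearMap.range g).injective_subtype).exists_pow (I := I)
  obtain ⟨k, hk⟩ := I.exists_pow_inf_eq_pow_smul (M := R) K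
  have hk := hk (t + k) (by lia)
  rw [Nat.add_sub_cancel] at hk
  let φ : K →ₗ[R] R ⧸ I ^ (t + k) := (I ^ (t + k)).mkQ ∘ₗ K.subtype
  have hφ : LinearMap.ker φ ≤ LinearMap.ker ((I.powTorsion E).subtype ∘ₗ g) := by
    intro x hx
    have hx' : (x : R) ∈ I ^ (t + k) := (Submodule.Quotient.mk_eq_zero _).1 hx
    have key : ∀ y ∈ I ^ t • (I ^ k • (⊤ : Submodule R R) ⊓ K), ∃ hy : y ∈ K, g ⟨y, hy⟩ = 0 := by
      intro y hy
      induction hy using Submodule.smul_induction_on' with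
      | smul r hr z hz =>
        refine ⟨K.smul_mem r hz.2, ?_⟩
        change g (r • ⟨z, hz.2⟩) = 0
        rw [map_smul]
        exact congr(($(ht r hr ⟨g ⟨z, hz.2⟩, LinearMap.mem_range_self _ _⟩)).1)
      | add y _ z _ hy hz =>
        obtain ⟨hy, hy'⟩ := hy
        obtain ⟨hz, hz'⟩ := hz
        refine ⟨K.add_mem hy hz, ?_⟩
        change g (⟨y, hy⟩ + ⟨z, hz⟩) = 0
        rw [map_add, hy', hz', add_zero]
    obtain ⟨_, h⟩ := key x (hk ▸ ⟨by simpa using hx', x.2⟩)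
    simpa using h
  obtain ⟨h, hh⟩ := Module.Injective.out (R := R) (Q := E) ((LinearMap.ker φ).liftQ φ le_rfl)
    (LinearMap.ker_eq_bot.1 (Submodule.ker_liftQ_eq_bot _ _ _ le_rfl))
    ((LinearMap.ker φ).liftQ _ hφ)
  refine ⟨LinearMap.codRestrict _ (h ∘ₗ (I ^ (t + k)).mkQ) fun c ↦ ⟨t + k, fun r hr ↦ ?_⟩,
    fun x hx ↦ Subtype.ext ?_⟩
  · rw [← map_smul, LinearMap.comp_apply, Submodule.mkQ_apply, smul_eq_mul,
      (Submodule.Quotient.mk_eq_zero _).2 (Ideal.mul_mem_right c _ hr), map_zero]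
  · exact hh (Submodule.Quotient.mk ⟨x, hx⟩)

namespace localCohomology

variable {R : Type u} [CommRing R] (I : Ideal R)

lemma Model.isPowTorsion (i : ℕ) (M : ModuleCat.{u} R) : I.IsPowTorsion (Model I i M) :=
  Model.exists_pow_smul_eq_zero I i

/-- Local cohomology of torsion modules vanishes in positive degrees. -/
lemma Model.subsingleton_succ_of_isPowTorsion [IsNoetherianRing R] (i : ℕ) (T : ModuleCat.{u} R)
    (hT : I.IsPowTorsion T) : Subsingleton (Model I (i + 1) T) := by
  let E := Injective.under T
  have : Module.Injective R E :=
    (Module.injective_iff_injective_object R E).2 (inferInstanceAs (Injective E))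
  have := (I.baer_powTorsion E).injective
  let J := ModuleCat.of R (I.powTorsion E)
  have : Injective J := Module.injective_object_of_injective_module R (I.powTorsion E)
  have hιm (x : T) : (Injective.ι T).hom x ∈ I.powTorsion E := by
    obtain ⟨t, ht⟩ := hT x
    exact ⟨t, fun r hr ↦ by rw [← map_smul, ht r hr, map_zero]⟩
  let f : T →ₗ[R] I.powTorsion E := LinearMap.codRestrict _ (Injective.ι T).hom hιm
  have hf : Function.Injective f := fun x y hxy ↦
    (ModuleCat.mono_iff_injective (Injective.ι T)).1 inferInstance congr(($hxy).1)
  let S : ShortComplex (ModuleCat.{u} R) :=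
    .mk (X₂ := J) (ModuleCat.ofHom f) (ModuleCat.ofHom (LinearMap.range f).mkQ)
      (by ext : 1; exact (LinearMap.range_mkQ_comp f))
  have hS : S.ShortExact :=
    { exact := (ShortComplex.ShortExact.moduleCat_exact_iff_function_exact S).2
        (LinearMap.exact_map_mkQ_range f)
      mono_f := (ModuleCat.mono_iff_injective _).2 hf
      epi_g := (ModuleCat.epi_iff_surjective _).2 (Submodule.mkQ_surjective _) }
  have hQ : I.IsPowTorsion S.X₃ :=
    Ideal.isPowTorsion_powTorsion.of_surjective (Submodule.mkQ_surjective (LinearMap.range f))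
  have hz (x : Model I (i + 1) T) : ∃ y, Model.δ I i hS y = x :=
    (Model.exact_δ_map I hS i x).1 (Subsingleton.elim (α := Model I (i + 1) J) _ _)
  refine subsingleton_of_forall_eq 0 fun x ↦ ?_
  obtain ⟨y, rfl⟩ := hz x
  cases i with
  | zero =>
    rw [(Model.exact_map_δ I hS 0 y)]
    obtain ⟨j, hj⟩ := Submodule.mkQ_surjective (LinearMap.range f) (Model.toModule I _ y)
    obtain ⟨t, ht⟩ := Ideal.isPowTorsion_powTorsion j
    obtain ⟨z, hz⟩ := Model.exists_toModule_eq I (M := J) ht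
    refine ⟨z, Model.toModule_injective I _ ?_⟩
    rw [Model.toModule_map, ← hj, hz]
    rfl
  | succ i =>
    have := Model.subsingleton_succ_of_isPowTorsion i S.X₃ hQ
    rw [Subsingleton.elim y 0, map_zero]

end localCohomology

section

variable {R : Type*} [CommRing R] [IsNoetherianRing R] {A B C : Type*} [AddCommGroup A]
  [Module R A] [AddCommGroup B] [Module R B] [AddCommGroup C] [Module R C]

lemma Module.Finite.of_exact_middle {f : A →ₗ[R] B} {g : B →ₗ[R] C} (h : Function.Exact f g)
    [Module.Finite R A] [Module.Finite R C] : Module.Finite R B := by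
  have := isNoetherian_of_range_eq_ker f g h.linearMap_ker_eq.symm
  infer_instance

lemma Module.Finite.of_exact_of_finite_ker {f : A →ₗ[R] B} {g : B →ₗ[R] C}
    (h : Function.Exact f g) [Module.Finite R A] (D : Submodule R C) [Module.Finite R D]
    (hD : LinearMap.range g ≤ D) : Module.Finite R B :=
  Module.Finite.of_exact_middle (f := f) (g := LinearMap.codRestrict D g fun b ↦ hD ⟨b, rfl⟩)
    fun b ↦ (Subtype.ext_iff).trans (h b)

/-- A module that is power torsion with respect to `y` and whose `y`-torsion has finite length
has finitely generated quotient modulo `y`. -/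
lemma Module.finite_quotient_range_lsmul_of_torsionBy (L : Type*) [AddCommGroup L] [Module R L]
    (y : R) (htors : ∀ l : L, ∃ n : ℕ, y ^ n • l = 0)
    [IsArtinian R (Submodule.torsionBy R L y)] [Module.Finite R (Submodule.torsionBy R L y)] :
    Module.Finite R (L ⧸ LinearMap.range (LinearMap.lsmul R L y)) := by
  let V : ℕ →o (Submodule R (Submodule.torsionBy R L y))ᵒᵈ :=
    { toFun k := OrderDual.toDual
        ((LinearMap.range (LinearMap.lsmul R L (y ^ k))).comap (Submodule.subtype _))
      monotone' := monotone_nat_of_le_succ fun k ↦ by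
        rintro ⟨x, hx⟩ ⟨l, hl⟩
        exact ⟨y • l, by simpa [smul_smul, ← pow_succ, ← pow_succ'] using hl⟩ }
  obtain ⟨k, hk⟩ := IsArtinian.monotone_stabilizes V
  have hV (n : ℕ) (x : L) (hx : y • x = 0) (hxk : ∃ l, y ^ (k + n) • l = x) :
      ∃ l, y ^ (k + (n + 1)) • l = x := by
    have h := (hk (k + n) (by lia)).symm.trans (hk (k + (n + 1)) (by lia))
    have hm : (⟨x, hx⟩ : Submodule.torsionBy R L y) ∈ OrderDual.ofDual (V (k + n)) := hxk
    rw [h] at hm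
    exact hm
  have hstep (n : ℕ) : ∀ x : L, y ^ n • x = 0 → (∃ l, y ^ k • l = x) →
      ∃ l, y ^ (k + 1) • l = x := by
    induction n with
    | zero => exact fun x hx _ ↦ ⟨0, by simpa using hx.symm⟩
    | succ n ih =>
      rintro x hx ⟨l, rfl⟩
      obtain ⟨w, hw⟩ := hV n (y ^ n • y ^ k • l) (by rw [smul_smul, ← pow_succ', hx])
        ⟨l, by rw [smul_smul, ← pow_add, add_comm]⟩
      obtain ⟨v, hv⟩ := ih (y ^ k • l - y ^ (k + 1) • w)
        (by rw [smul_sub, ← hw, smul_smul, ← pow_add, sub_eq_zero]; congr 2; lia)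
        ⟨l - y • w, by rw [smul_sub, smul_smul, pow_succ]⟩
      exact ⟨v + w, by rw [smul_add, hv, sub_add_cancel]⟩
  have hfin (n : ℕ) : Module.Finite R (Submodule.torsionBy R L (y ^ n)) := by
    induction n with
    | zero =>
      have : Submodule.torsionBy R L (y ^ 0) = ⊥ := by
        rw [pow_zero, Submodule.torsionBy_one]
      rw [this]
      infer_instance
    | succ n ih =>
      refine Module.Finite.of_exact_of_finite_ker (A := Submodule.torsionBy R L y)
        (f := Submodule.inclusion fun x hx ↦ ?_)
        (g := LinearMap.lsmul R L y ∘ₗ (Submodule.torsionBy R L (y ^ (n + 1))).subtype)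
        (fun x ↦ ?_) (Submodule.torsionBy R L (y ^ n)) ?_
      · rw [Submodule.mem_torsionBy_iff] at hx ⊢
        rw [pow_succ, mul_smul, hx, smul_zero]
      · exact ⟨fun h ↦ ⟨⟨x, h⟩, rfl⟩, by rintro ⟨z, rfl⟩; exact z.2⟩
      · rintro _ ⟨x, rfl⟩
        obtain ⟨x, hx⟩ := x
        rwa [Submodule.mem_torsionBy_iff, pow_succ, mul_smul] at hx
  refine Module.Finite.of_surjective
    ((LinearMap.range (LinearMap.lsmul R L y)).mkQ ∘ₗ (Submodule.torsionBy R L (y ^ k)).subtype)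
    fun q ↦ ?_
  obtain ⟨l, rfl⟩ := Submodule.mkQ_surjective _ q
  obtain ⟨n, hn⟩ := htors (y ^ k • l)
  obtain ⟨w, hw⟩ := hstep n _ hn ⟨l, rfl⟩
  refine ⟨⟨l - y • w, ?_⟩, ?_⟩
  · rw [Submodule.mem_torsionBy_iff, smul_sub, smul_smul, ← pow_succ, hw, sub_self]
  · refine (Submodule.Quotient.eq _).2 ⟨-w, ?_⟩
    simp

end

/-- The short complex attached to an exact pair of linear maps. -/
abbrev ModuleCat.shortComplexOfExact {R : Type u} [CommRing R] {A B C : Type u} [AddCommGroup A]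
    [Module R A] [AddCommGroup B] [Module R B] [AddCommGroup C] [Module R C] {f : A →ₗ[R] B}
    {g : B →ₗ[R] C} (h : Function.Exact f g) : ShortComplex (ModuleCat.{u} R) :=
  .mk (ModuleCat.ofHom f) (ModuleCat.ofHom g) (by ext : 1; exact h.linearMap_comp_eq_zero)

lemma ModuleCat.shortExact_shortComplexOfExact {R : Type u} [CommRing R] {A B C : Type u}
    [AddCommGroup A] [Module R A] [AddCommGroup B] [Module R B] [AddCommGroup C] [Module R C]
    {f : A →ₗ[R] B} {g : B →ₗ[R] C} (h : Function.Exact f g) (hf : Function.Injective f)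
    (hg : Function.Surjective g) : (ModuleCat.shortComplexOfExact h).ShortExact where
  exact := (ShortComplex.ShortExact.moduleCat_exact_iff_function_exact _).2 h
  mono_f := (ModuleCat.mono_iff_injective _).2 hf
  epi_g := (ModuleCat.epi_iff_surjective _).2 hg

/-- All the modules `Ext^i(R / I, N)` are finitely generated. -/
def Ideal.IsExtFinite {R : Type u} [CommRing R] (I : Ideal R) (N : Type u) [AddCommGroup N]
    [Module R N] : Prop :=
  ∀ i : ℕ, Module.Finite R (Abelian.Ext (ModuleCat.of R (R ⧸ I)) (ModuleCat.of R N) i)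

namespace Ideal.IsExtFinite

open Abelian.Ext

variable {R : Type u} [CommRing R] {I : Ideal R}

lemma top (N : Type u) [AddCommGroup N] [Module R N] : (⊤ : Ideal R).IsExtFinite N := fun i ↦ by
  have : Subsingleton (Abelian.Ext (ModuleCat.of R (R ⧸ (⊤ : Ideal R))) (ModuleCat.of R N) i) :=
    subsingleton_of_forall_eq 0 fun x ↦ by
      rw [← one_smul R x, smul_eq_zero_of_mem x Submodule.mem_top]
  infer_instance

variable {A B C : Type u} [AddCommGroup A] [Module R A] [AddCommGroup B] [Module R B]
  [AddCommGroup C] [Module R C] {f : A →ₗ[R] B} {g : B →ₗ[R] C}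

lemma finite_ker (h : Function.Exact f g) (hf : Function.Injective f)
    (hg : Function.Surjective g) (hC : I.IsExtFinite C) (i : ℕ) :
    Module.Finite R (LinearMap.ker ((mk₀ (ModuleCat.ofHom f)).postcompOfLinear R
      (ModuleCat.of R (R ⧸ I)) (add_zero i))) := by
  have hS := ModuleCat.shortExact_shortComplexOfExact h hf hg
  cases i with
  | zero =>
    have := (ModuleCat.mono_iff_injective (ModuleCat.ofHom f)).2 hf
    rw [LinearMap.ker_eq_bot.2 (postcomp_mk₀_injective_of_mono _ (ModuleCat.ofHom f))]
    infer_instance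
  | succ i =>
    have := hC i
    have he := exact_postcompOfLinear_extClass_f (R := R) hS (ModuleCat.of R (R ⧸ I)) i
    rw [show LinearMap.ker _ = _ from he.linearMap_ker_eq]
    exact Module.Finite.range _

variable [IsNoetherianRing R]

lemma of_finite (N : Type u) [AddCommGroup N] [Module R N] [Module.Finite R N] :
    I.IsExtFinite N := fun _ ↦ inferInstance

lemma of_exact_middle (h : Function.Exact f g) (hf : Function.Injective f)
    (hg : Function.Surjective g) (hA : I.IsExtFinite A) (hC : I.IsExtFinite C) :
    I.IsExtFinite B := fun i ↦
  have hS := ModuleCat.shortExact_shortComplexOfExact h hf hg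
  have := hA i
  have := hC i
  Module.Finite.of_exact_middle
    (exact_postcompOfLinear_f_g (R := R) hS (ModuleCat.of R (R ⧸ I)) i)

lemma of_exact_right (h : Function.Exact f g) (hf : Function.Injective f)
    (hg : Function.Surjective g) (hA : I.IsExtFinite A) (hB : I.IsExtFinite B) :
    I.IsExtFinite C := fun i ↦
  have hS := ModuleCat.shortExact_shortComplexOfExact h hf hg
  have := hB i
  have := hA (i + 1)
  Module.Finite.of_exact_middle
    (exact_postcompOfLinear_g_extClass (R := R) hS (ModuleCat.of R (R ⧸ I)) i)

lemma of_linearEquiv (e : A ≃ₗ[R] B) (hA : I.IsExtFinite A) : I.IsExtFinite B :=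
  of_exact_right (A := PUnit) (f := 0) (g := e.toLinearMap) (fun x ↦ by simp [eq_comm (a := (0 : A))])
    (fun _ _ _ ↦ rfl) e.surjective (of_finite _) hA

/-- Melkersson's criterion. -/
lemma of_lsmul (N : Type u) [AddCommGroup N] [Module R N] {x : R} (hx : x ∈ I)
    (hK : I.IsExtFinite (LinearMap.ker (LinearMap.lsmul R N x)))
    (hC : I.IsExtFinite (N ⧸ LinearMap.range (LinearMap.lsmul R N x))) :
    I.IsExtFinite N := fun i ↦ by
  let f := LinearMap.lsmul R N x
  have h₁ : Function.Exact (LinearMap.ker f).subtype f.rangeRestrict := by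
    rw [LinearMap.exact_iff, LinearMap.ker_rangeRestrict, Submodule.range_subtype]
  have h₂ : Function.Exact (LinearMap.range f).subtype (LinearMap.range f).mkQ := by
    rw [LinearMap.exact_iff, Submodule.ker_mkQ, Submodule.range_subtype]
  have hS := ModuleCat.shortExact_shortComplexOfExact h₁ (Submodule.injective_subtype _)
    f.surjective_rangeRestrict
  have := hK i
  let D := LinearMap.ker ((mk₀ (ModuleCat.ofHom (LinearMap.range f).subtype)).postcompOfLinear R
    (ModuleCat.of R (R ⧸ I)) (add_zero i))
  have : Module.Finite R D := finite_ker h₂ (Submodule.injective_subtype _) (Submodule.mkQ_surjective _) hC i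
  refine Module.Finite.of_exact_of_finite_ker
    (exact_postcompOfLinear_f_g (R := R) hS (ModuleCat.of R (R ⧸ I)) i) D ?_
  rintro _ ⟨z, rfl⟩
  change (z.comp (mk₀ (ModuleCat.ofHom f.rangeRestrict)) (add_zero i)).comp
    (mk₀ (ModuleCat.ofHom (LinearMap.range f).subtype)) (add_zero i) = 0
  rw [comp_assoc_of_third_deg_zero, mk₀_comp_mk₀]
  have : ModuleCat.ofHom f.rangeRestrict ≫ ModuleCat.ofHom (LinearMap.range f).subtype =
      x • 𝟙 (ModuleCat.of R N) := rfl
  rw [this, ← smul_eq_comp_mk₀, smul_eq_zero_of_mem z hx]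

lemma of_torsionBy (N : Type u) [AddCommGroup N] [Module R N] {x : R} (hx : x ∈ I)
    (htors : ∀ n : N, ∃ k : ℕ, x ^ k • n = 0)
    [IsArtinian R (Submodule.torsionBy R N x)] [Module.Finite R (Submodule.torsionBy R N x)] :
    I.IsExtFinite N := by
  have := Module.finite_quotient_range_lsmul_of_torsionBy N x htors
  have hK : I.IsExtFinite (Submodule.torsionBy R N x) := of_finite _
  exact of_lsmul N hx hK (of_finite _)

end Ideal.IsExtFinite

namespace Ideal

variable {R : Type*} [CommRing R] [IsNoetherianRing R] (I : Ideal R) (M : Type*) [AddCommGroup M]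
  [Module R M] [Module.Finite R M]

lemma powTorsion_quotient_powTorsion : I.powTorsion (M ⧸ I.powTorsion M) = ⊥ := by
  refine eq_bot_iff.2 fun q ↦ ?_
  obtain ⟨m, rfl⟩ := Submodule.mkQ_surjective _ q
  rintro ⟨t, ht⟩
  obtain ⟨s, hs⟩ := (I.isPowTorsion_powTorsion (M := M)).exists_pow
  refine (Submodule.Quotient.mk_eq_zero _).2 ⟨s + t, fun r hr ↦ ?_⟩
  rw [pow_add] at hr
  induction hr using Submodule.mul_induction_on' with
  | mem_mul_mem a ha b hb =>
    have hbm : b • m ∈ I.powTorsion M := (Submodule.Quotient.mk_eq_zero _).1 (ht b hb)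
    rw [mul_smul]
    exact congr(($(hs a ha ⟨b • m, hbm⟩)).1)
  | add a _ b _ ha hb => rw [add_smul, ha, hb, add_zero]

variable {I M}

lemma exists_isSMulRegular_of_powTorsion_eq_bot (h : I.powTorsion M = ⊥) :
    ∃ x ∈ I, IsSMulRegular M x := by
  have : Subsingleton ((R ⧸ I) →ₗ[R] M) := subsingleton_of_forall_eq 0 fun f ↦ by
    ext
    change f (Ideal.Quotient.mk I 1) = 0
    rw [← Submodule.mem_bot R, ← h]
    refine ⟨1, fun r hr ↦ ?_⟩
    rw [pow_one] at hr
    rw [← map_smul, ← map_zero f]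
    congr 1
    exact (Submodule.Quotient.mk_eq_zero _).2 (Ideal.mul_mem_right _ _ hr)
  simpa [Ideal.annihilator_quotient] using IsSMulRegular.subsingleton_linearMap_iff.1 this

end Ideal

namespace Module

variable {R : Type*} [CommRing R] [IsNoetherianRing R] {M : Type*} [AddCommGroup M]
  [Module R M] [Module.Finite R M]

lemma isArtinian_of_supportDim_le_zero (h : supportDim R M ≤ 0) : IsArtinian R M := by
  rw [supportDim_eq_ringKrullDim_quotient_annihilator] at h
  have : Ring.KrullDimLE 0 (R ⧸ annihilator R M) := Ring.krullDimLE_iff.2 h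
  have : IsArtinianRing (R ⧸ annihilator R M) :=
    IsNoetherianRing.isArtinianRing_of_krullDimLE_zero
  let := quotientAnnihilator (R := R) (M := M)
  have : IsScalarTower R (R ⧸ annihilator R M) M := IsTorsionBySet.isScalarTower _
  have := Module.Finite.of_restrictScalars_finite R (R ⧸ annihilator R M) M
  exact isArtinian_of_surjective_algebraMap (R := R ⧸ annihilator R M) Ideal.Quotient.mk_surjective

lemma isPowTorsion_of_supportDim_le_zero [IsLocalRing R] {I : Ideal R} (hI : I ≠ ⊤)
    (h : supportDim R M ≤ 0) : I.IsPowTorsion M := by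
  cases subsingleton_or_nontrivial M
  · exact fun m ↦ ⟨0, fun r _ ↦ Subsingleton.elim _ _⟩
  have h0 : supportDim R M = 0 := le_antisymm h <| by
    have := supportDim_ne_bot_of_nontrivial R M
    generalize supportDim R M = d at *
    cases d with
    | bot => exact absurd rfl this
    | coe d => exact WithBot.coe_nonneg.2 zero_le
  have hs := support_of_supportDim_eq_zero R M h0
  rw [Module.support_eq_zeroLocus] at hs
  have hrad : I ≤ (annihilator R M).radical := by
    rw [← PrimeSpectrum.vanishingIdeal_zeroLocus_eq_radical, hs,
      PrimeSpectrum.vanishingIdeal_zeroLocus_eq_radical]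
    exact (IsLocalRing.le_maximalIdeal hI).trans Ideal.le_radical
  obtain ⟨k, hk⟩ := Ideal.exists_pow_le_of_le_radical_of_fg_radical hrad (IsNoetherian.noetherian _)
  exact fun m ↦ ⟨k, fun r hr ↦ mem_annihilator.1 (hk hr) m⟩

end Module

namespace LinearMap

variable {R A B N N' : Type*} [CommRing R] [AddCommGroup A] [Module R A] [AddCommGroup B]
  [Module R B] [AddCommGroup N] [Module R N] [AddCommGroup N'] [Module R N']

lemma exact_lsmul_of_linearEquiv_left (e : N ≃ₗ[R] N') {x : R} {δ : A →ₗ[R] N'}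
    (h : Function.Exact δ (lsmul R N' x)) :
    Function.Exact (e.symm.toLinearMap ∘ₗ δ) (lsmul R N x) := fun z ↦ by
  have := h (e z)
  simp only [lsmul_apply, ← map_smul, EmbeddingLike.map_eq_zero_iff, Set.mem_range, comp_apply,
    LinearEquiv.coe_coe, LinearEquiv.symm_apply_eq] at this ⊢
  exact this

lemma exact_lsmul_of_linearEquiv_right (e : N ≃ₗ[R] N') {x : R} {π : N' →ₗ[R] B}
    (h : Function.Exact (lsmul R N' x) π) :
    Function.Exact (lsmul R N x) (π ∘ₗ e.toLinearMap) := fun z ↦ by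
  refine (h (e z)).trans ⟨?_, ?_⟩
  · rintro ⟨y, hy⟩
    exact ⟨e.symm y, e.injective (by simpa using hy)⟩
  · rintro ⟨y, rfl⟩
    exact ⟨e y, by simp⟩

end LinearMap

namespace localCohomology

variable {R : Type u} [CommRing R] [IsNoetherianRing R] (I : Ideal R)

lemma Model.map_bijective_of_isPowTorsion {S : ShortComplex (ModuleCat.{u} R)}
    (hS : S.ShortExact) (hT : I.IsPowTorsion S.X₁) (i : ℕ) :
    Function.Bijective (Model.map I (i + 1) S.g) := by
  have := Model.subsingleton_succ_of_isPowTorsion I i S.X₁ hT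
  have := Model.subsingleton_succ_of_isPowTorsion I (i + 1) S.X₁ hT
  refine ⟨(injective_iff_map_eq_zero _).2 fun x hx ↦ ?_, fun y ↦ ?_⟩
  · obtain ⟨z, rfl⟩ := (Model.exact_map_map I hS (i + 1) x).1 hx
    rw [Subsingleton.elim z 0, map_zero]
  · exact (Model.exact_map_δ I hS (i + 1) y).1 (Subsingleton.elim _ _)

open scoped Pointwise in
omit [IsNoetherianRing R] in
lemma Model.exists_exact_lsmul_of_isSMulRegular (M : Type u) [AddCommGroup M] [Module R M] {x : R}
    (hx : IsSMulRegular M x) (i : ℕ) :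
    ∃ (δ : Model I i (ModuleCat.of R (QuotSMulTop x M)) →ₗ[R] Model I (i + 1) (ModuleCat.of R M))
      (π : Model I (i + 1) (ModuleCat.of R M) →ₗ[R]
        Model I (i + 1) (ModuleCat.of R (QuotSMulTop x M))),
      Function.Exact δ (LinearMap.lsmul R (Model I (i + 1) (ModuleCat.of R M)) x) ∧
      Function.Exact (LinearMap.lsmul R (Model I (i + 1) (ModuleCat.of R M)) x) π := by
  have hE : Function.Exact (LinearMap.lsmul R M x) (x • (⊤ : Submodule R M)).mkQ := by
    rw [LinearMap.exact_iff, Submodule.ker_mkQ]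
    exact (LinearMap.range_eq_map _).symm
  have hS := ModuleCat.shortExact_shortComplexOfExact hE hx (Submodule.mkQ_surjective _)
  have hx' : Model.map I (i + 1) (ModuleCat.ofHom (LinearMap.lsmul R M x)) =
      LinearMap.lsmul R (Model I (i + 1) (ModuleCat.of R M)) x :=
    LinearMap.ext (Model.map_smul_id I (i + 1) (M := ModuleCat.of R M) x)
  rw [← hx']
  exact ⟨_, _, Model.exact_δ_map I hS i, Model.exact_map_map I hS (i + 1)⟩

/-- Local cohomology in positive degrees is controlled by the local cohomology of a module of
smaller dimension. -/
lemma Model.exists_exact_lsmul [IsLocalRing R] {I : Ideal R} (hI : I ≠ ⊤) (M : ModuleCat.{u} R)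
    [Module.Finite R M] (n : ℕ) (hM : Module.supportDim R M ≤ n + 1) :
    ∃ x ∈ I, ∃ Q : ModuleCat.{u} R, Module.Finite R Q ∧ Module.supportDim R Q ≤ n ∧
      ∀ i, ∃ (δ : Model I i Q →ₗ[R] Model I (i + 1) M)
        (π : Model I (i + 1) M →ₗ[R] Model I (i + 1) Q),
        Function.Exact δ (LinearMap.lsmul R (Model I (i + 1) M) x) ∧
        Function.Exact (LinearMap.lsmul R (Model I (i + 1) M) x) π := by
  let M' := M ⧸ I.powTorsion M
  obtain ⟨x, hx, hreg⟩ := Ideal.exists_isSMulRegular_of_powTorsion_eq_bot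
    (I.powTorsion_quotient_powTorsion M)
  have hM' : Module.supportDim R M' ≤ n + 1 :=
    (Module.supportDim_le_of_surjective _ (Submodule.mkQ_surjective (I.powTorsion M))).trans hM
  have hQ : Module.supportDim R (QuotSMulTop x M') ≤ n := by
    rwa [← Module.supportDim_quotSMulTop_succ_eq_supportDim hreg
      (IsLocalRing.le_maximalIdeal hI hx), ENat.WithBot.add_le_add_one_right_iff] at hM'
  refine ⟨x, hx, ModuleCat.of R (QuotSMulTop x M'), inferInstanceAs (Module.Finite R (M' ⧸ _)),
    hQ, fun i ↦ ?_⟩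
  have hT : Function.Exact (I.powTorsion M).subtype (I.powTorsion M).mkQ := by
    rw [LinearMap.exact_iff, Submodule.ker_mkQ, Submodule.range_subtype]
  let e := LinearEquiv.ofBijective _ <| Model.map_bijective_of_isPowTorsion I
    (ModuleCat.shortExact_shortComplexOfExact hT (Submodule.injective_subtype _)
      (Submodule.mkQ_surjective _)) I.isPowTorsion_powTorsion i
  obtain ⟨δ, π, hδ, hπ⟩ := Model.exists_exact_lsmul_of_isSMulRegular I M' hreg i
  exact ⟨_, _, LinearMap.exact_lsmul_of_linearEquiv_left e hδ,
    LinearMap.exact_lsmul_of_linearEquiv_right e hπ⟩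

lemma Model.finite_zero (M : ModuleCat.{u} R) [Module.Finite R M] :
    Module.Finite R (Model I 0 M) :=
  Module.Finite.of_injective _ (Model.toModule_injective I M)

variable {I} [IsLocalRing R]

/-- Local cohomology of a module of finite length has finite length. -/
lemma Model.isArtinian_and_finite (hI : I ≠ ⊤) (M : ModuleCat.{u} R) [Module.Finite R M]
    (hM : Module.supportDim R M ≤ 0) (i : ℕ) :
    IsArtinian R (Model I i M) ∧ Module.Finite R (Model I i M) := by
  cases i with
  | zero =>
    have := Module.isArtinian_of_supportDim_le_zero hM
    exact ⟨isArtinian_of_injective _ (Model.toModule_injective I M), Model.finite_zero I M⟩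
  | succ i =>
    have := Model.subsingleton_succ_of_isPowTorsion I i M
      (Module.isPowTorsion_of_supportDim_le_zero hI hM)
    exact ⟨inferInstance, inferInstance⟩

lemma Model.isExtFinite_submodule (hI : I ≠ ⊤) (M : ModuleCat.{u} R) [Module.Finite R M]
    (hM : Module.supportDim R M ≤ 1) (i : ℕ) (P : Submodule R (Model I i M)) :
    I.IsExtFinite P := by
  cases i with
  | zero =>
    have := Model.finite_zero I M
    exact .of_finite P
  | succ i =>
    obtain ⟨x, hx, Q, _, hQ, h⟩ := Model.exists_exact_lsmul hI M 0 (by simpa using hM)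
    obtain ⟨δ, -, hδ, -⟩ := h i
    obtain ⟨_, _⟩ := Model.isArtinian_and_finite hI Q hQ i
    let f : Submodule.torsionBy R P x →ₗ[R] LinearMap.range δ :=
      LinearMap.codRestrict _ (P.subtype ∘ₗ Submodule.subtype _)
        fun p ↦ (hδ _).1 congr(($(p.2)).1)
    have hf : Function.Injective f := fun p q hpq ↦
      Subtype.ext (Subtype.ext congr(($hpq).1))
    have := isArtinian_of_injective f hf
    have := Module.Finite.of_injective f hf
    refine .of_torsionBy P hx fun p ↦ ?_
    obtain ⟨t, ht⟩ := Model.isPowTorsion I (i + 1) M p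
    exact ⟨t, Subtype.ext (ht _ (Ideal.pow_mem_pow hx t))⟩

lemma Model.isExtFinite (I : Ideal R) (M : ModuleCat.{u} R) [Module.Finite R M]
    (hM : Module.supportDim R M ≤ 2) (i : ℕ) : I.IsExtFinite (Model I i M) := by
  by_cases hI : I = ⊤
  · subst hI
    exact .top _
  cases i with
  | zero =>
    have := Model.finite_zero I M
    exact .of_finite _
  | succ i =>
    obtain ⟨x, hx, Q, _, hQ, h⟩ := Model.exists_exact_lsmul hI M 1 (by
      rwa [Nat.cast_one, one_add_one_eq_two])
    obtain ⟨δ, π, hδ, hπ⟩ := h i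
    rw [Nat.cast_one] at hQ
    refine .of_lsmul _ hx ?_ ?_
    · rw [hδ.linearMap_ker_eq]
      have he : Function.Exact (LinearMap.ker δ).subtype δ.rangeRestrict := by
        rw [LinearMap.exact_iff, LinearMap.ker_rangeRestrict, Submodule.range_subtype]
      exact .of_exact_right he (Submodule.injective_subtype _) δ.surjective_rangeRestrict
        (Model.isExtFinite_submodule hI Q hQ i _)
        (.of_linearEquiv Submodule.topEquiv (Model.isExtFinite_submodule hI Q hQ i ⊤))
    · rw [← hπ.linearMap_ker_eq]
      exact .of_linearEquiv π.quotKerEquivRange.symm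
        (Model.isExtFinite_submodule hI Q hQ (i + 1) _)

end localCohomology

lemma Ideal.IsPowTorsion.support_subset {R : Type*} [CommRing R] {I : Ideal R} {N : Type*}
    [AddCommGroup N] [Module R N] (h : I.IsPowTorsion N) :
    Module.support R N ⊆ PrimeSpectrum.zeroLocus (I : Set R) := by
  intro p hp r hr
  obtain ⟨m, hm⟩ := Module.mem_support_iff_exists_annihilator.1 hp
  obtain ⟨t, ht⟩ := h m
  refine p.2.mem_of_pow_mem t (hm ?_)
  rw [Submodule.mem_annihilator_span_singleton]
  exact ht _ (Ideal.pow_mem_pow hr t)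

theorem stmt5 (R : Type u) [CommRing R] [IsNoetherianRing R] [IsLocalRing R]
    (hdim : ringKrullDim R ≤ 2) (I : Ideal R)
    (M : Type u) [AddCommGroup M] [Module R M] [Module.Finite R M] :
    ∀ i : ℕ, IsCofinite R I ((localCohomology I i).obj (ModuleCat.of R M)) := by
  intro i
  let e := localCohomology.linearEquivModel I i (ModuleCat.of R M)
  refine ⟨Ideal.IsPowTorsion.support_subset
    ((localCohomology.Model.isPowTorsion I i _).of_injective (f := e.toLinearMap) e.injective),
    fun n ↦ ?_⟩
  have h := (localCohomology.Model.isExtFinite I (ModuleCat.of R M)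
    ((Module.supportDim_le_ringKrullDim R M).trans hdim) i).of_linearEquiv e.symm n
  exact Module.Finite.equiv (ModuleCat.extLinearEquiv _ _ n).symm
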